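/- For every k ≥ 2, CPDL⁺(TW_k) is strictly less expressive than CPDL⁺(TW_{k+1}), both over all structures and over Kripke structures: CPDL⁺(TW_k) ≦ CPDL⁺(TW_{k+1}), and there is a CPDL⁺(TW_{k+1}) formula not equivalent over Kripke structures to any CPDL⁺(TW_k) formula. Concretely, for m ≥ 3 and a fixed atomic program a, the (m+1)-clique formula ξ_{m+1} = ⟨C[x₁,x_{m+1}]⟩ ∧ ¬⟨C'[x₁,y]⟩, where C = {a(x_i,x_j) : 1 ≤ i < j ≤ m+1} and C' = {a(x₁,y), a(y,y)}, belongs to CPDL⁺(TW_m), is satisfiable, and is not equivalent over Kripke structures to any CPDL⁺(TW_{m−1}) formula. -/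

import Mathlib

namespace PaperCPDL

/-- Relational structures over a fixed countably infinite signature:
for every arity `n` there are countably many relation names, indexed by `ℕ`. -/
structure Struct : Type 1 where
  World : Type
  rel : (n : ℕ) → ℕ → (Fin n → World) → Prop

namespace Struct

variable (K : Struct)

/-- Atomic propositions are the unary relation names. -/
def prop (p : ℕ) (w : K.World) : Prop := K.rel 1 p fun _ => w

/-- Atomic programs are the binary relation names. -/
def prog (a : ℕ) (u v : K.World) : Prop :=
  K.rel 2 a fun i => if (i : ℕ) = 0 then u else v

/-- A Kripke structure interprets every relation of arity `> 2` as the empty relation. -/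
def IsKripke : Prop := ∀ n, 2 < n → ∀ r (t : Fin n → K.World), ¬ K.rel n r t

/-- Gaifman adjacency: `u` and `v` occur together in a tuple of some relation. -/
def gadj (u v : K.World) : Prop :=
  ∃ (n r : ℕ) (t : Fin n → K.World), K.rel n r t ∧ (∃ i, t i = u) ∧ ∃ j, t j = v

/-- distance at most 1 in the Gaifman graph. -/
def near (u v : K.World) : Prop := u = v ∨ K.gadj u v

/-- same connected component of the Gaifman graph. -/
def sameComp (u v : K.World) : Prop := Relation.ReflTransGen K.gadj u v

/-- finite degree: every world has finitely many Gaifman-neighbours. -/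
def FiniteDegree : Prop := ∀ u, {v | K.gadj u v}.Finite

end Struct

/-- r-atoms `R(x₁,…,xₙ)`: a relation name with its argument variables. -/
structure RAtom where
  name : ℕ
  args : List ℕ

mutual
  /-- Formulas of (U)CPDL⁺ (together with `loop` and program intersection,
  used to carve out the various fragments). -/
  inductive Fml : Type where
    | prop : ℕ → Fml
    | neg : Fml → Fml
    | and : Fml → Fml → Fml
    | diam : Prog → Fml
    | loop : Prog → Fml
  /-- Programs. -/
  inductive Prog : Type where
    | eps : Prog
    | atom : ℕ → Prog
    | conv : ℕ → Prog
    | union : Prog → Prog → Prog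
    | comp : Prog → Prog → Prog
    | star : Prog → Prog
    | test : Fml → Prog
    | inter : Prog → Prog → Prog
    | univ : Prog
    | cq : PList → List RAtom → ℕ → ℕ → Prog
  /-- Finite lists of p-atoms `π(x,y)`. -/
  inductive PList : Type where
    | nil : PList
    | cons : Prog → ℕ → ℕ → PList → PList
end

/-- satisfaction of an r-atom under an assignment. -/
def Struct.ratomSat (K : Struct) (f : ℕ → K.World) (r : RAtom) : Prop :=
  K.rel r.args.length r.name fun i => f (r.args.get i)

mutual
  /-- semantics of formulas. -/
  def evalF (K : Struct) : Fml → K.World → Prop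
    | .prop p, w => K.prop p w
    | .neg φ, w => ¬ evalF K φ w
    | .and φ ψ, w => evalF K φ w ∧ evalF K ψ w
    | .diam π, w => ∃ v, evalP K π w v
    | .loop π, w => evalP K π w w
  /-- semantics of programs. -/
  def evalP (K : Struct) : Prog → K.World → K.World → Prop
    | .eps, u, v => u = v
    | .atom a, u, v => K.prog a u v
    | .conv a, u, v => K.prog a v u
    | .union π₁ π₂, u, v => evalP K π₁ u v ∨ evalP K π₂ u v
    | .comp π₁ π₂, u, v => ∃ w, evalP K π₁ u w ∧ evalP K π₂ w v
    | .star π, u, v => Relation.ReflTransGen (fun a b => evalP K π a b) u v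
    | .test φ, u, v => u = v ∧ evalF K φ u
    | .inter π₁ π₂, u, v => evalP K π₁ u v ∧ evalP K π₂ u v
    | .univ, _, _ => True
    | .cq ps rs xs xt, u, v =>
        ∃ f : ℕ → K.World, f xs = u ∧ f xt = v ∧ evalPL K f ps ∧ ∀ r ∈ rs, K.ratomSat f r
  /-- semantics of a list of p-atoms. -/
  def evalPL (K : Struct) (f : ℕ → K.World) : PList → Prop
    | .nil => True
    | .cons π x y ps => evalP K π (f x) (f y) ∧ evalPL K f ps
end

/-! ## Conjunctive programs: variables, underlying graph, well-formedness -/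

/-- variables occurring in a list of p-atoms. -/
def PList.vars : PList → List ℕ
  | .nil => []
  | .cons _ x y ps => x :: y :: ps.vars

/-- variables of a conjunctive program given by p-atoms `ps` and r-atoms `rs`. -/
def cqVars (ps : PList) (rs : List RAtom) : List ℕ :=
  ps.vars ++ (rs.map RAtom.args).flatten

/-- co-occurrence of two variables in a p-atom of the list. -/
def PList.coOcc (x y : ℕ) : PList → Prop
  | .nil => False
  | .cons _ a b ps => ((x = a ∨ x = b) ∧ (y = a ∨ y = b)) ∨ PList.coOcc x y ps

/-- adjacency in the graph `G_C`: co-occurrence of two variables in some atom. -/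
def atomAdj (ps : PList) (rs : List RAtom) (x y : ℕ) : Prop :=
  ps.coOcc x y ∨ ∃ r ∈ rs, x ∈ r.args ∧ y ∈ r.args

/-- adjacency in the underlying graph of `C[x_s,x_t]`: `G_C` plus the edge `{x_s,x_t}`. -/
def ugAdj (ps : PList) (rs : List RAtom) (xs xt : ℕ) (x y : ℕ) : Prop :=
  atomAdj ps rs x y ∨ (x = xs ∧ y = xt) ∨ (x = xt ∧ y = xs)

/-- base well-formedness of a conjunctive program `C[x_s,x_t]`:
`x_s,x_t ∈ Vars(C)`, every r-atom has arity `> 2`, and `G_C` is connected. -/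
def cqWF (ps : PList) (rs : List RAtom) (xs xt : ℕ) : Prop :=
  xs ∈ cqVars ps rs ∧ xt ∈ cqVars ps rs ∧
  (∀ r ∈ rs, 2 < r.args.length) ∧
  ∀ x ∈ cqVars ps rs, ∀ y ∈ cqVars ps rs, Relation.ReflTransGen (atomAdj ps rs) x y

/-! ## Tree decompositions and tree-width -/

/-- A tree decomposition of the graph with vertex set `V` and adjacency `adj`. -/
structure TreeDecomp {α : Type} (V : Set α) (adj : α → α → Prop) where
  /-- the nodes of the tree -/
  B : Type
  /-- the tree -/
  tree : SimpleGraph B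
  isTree : tree.IsTree
  /-- the bags -/
  bag : B → Set α
  cover_vert : ∀ v ∈ V, ∃ b, v ∈ bag b
  cover_edge : ∀ u v, adj u v → ∃ b, u ∈ bag b ∧ v ∈ bag b
  bags_conn : ∀ (v : α) (b₁ b₂ : B), v ∈ bag b₁ → v ∈ bag b₂ →
      ∃ p : tree.Walk b₁ b₂, ∀ x ∈ p.support, v ∈ bag x

/-- the width of a tree decomposition is at most `k`. -/
def TreeDecomp.WidthLE {α : Type} {V : Set α} {adj : α → α → Prop}
    (td : TreeDecomp V adj) (k : ℕ) : Prop :=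
  ∀ b, (td.bag b).Finite ∧ (td.bag b).ncard ≤ k + 1

/-- the graph `(V, adj)` has tree-width at most `k`. -/
def TreewidthLE {α : Type} (V : Set α) (adj : α → α → Prop) (k : ℕ) : Prop :=
  ∃ td : TreeDecomp V adj, td.WidthLE k

/-- the Gaifman graph of the structure `K` has tree-width at most `k`. -/
def Struct.twLE (K : Struct) (k : ℕ) : Prop :=
  TreewidthLE (Set.univ : Set K.World) K.gadj k

/-- A good tree decomposition: along every tree edge one bag contains the other,
and the tree is binary (it has a root of degree `≤ 2`, all other nodes have degree `≤ 3`). -/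
def TreeDecomp.Good {α : Type} {V : Set α} {adj : α → α → Prop} (td : TreeDecomp V adj) : Prop :=
  (∀ b b', td.tree.Adj b b' → td.bag b ⊆ td.bag b' ∨ td.bag b' ⊆ td.bag b) ∧
  ∃ r : td.B, ∀ b, {b' | td.tree.Adj b b'}.Finite ∧
    ((b = r → {b' | td.tree.Adj b b'}.ncard ≤ 2) ∧ (b ≠ r → {b' | td.tree.Adj b b'}.ncard ≤ 3))

/-! ## Fragments -/

/-- all p-atoms of the list are of the form `π(x,x)` for the fixed variable `x`. -/
def PList.allOn (x : ℕ) : PList → Prop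
  | .nil => True
  | .cons _ a b ps => a = x ∧ b = x ∧ PList.allOn x ps

/-- A fragment specification: which of `loop`, `∩`, `U` are allowed, and which
shapes of conjunctive programs are allowed. -/
structure Frag where
  loopOK : Prop
  interOK : Prop
  univOK : Prop
  cqOK : PList → List RAtom → ℕ → ℕ → Prop

mutual
  /-- the formula belongs to the fragment `F`. -/
  def Fml.In : Frag → Fml → Prop
    | _, .prop _ => True
    | F, .neg φ => Fml.In F φ
    | F, .and φ ψ => Fml.In F φ ∧ Fml.In F ψ
    | F, .diam π => Prog.In F π
    | F, .loop π => F.loopOK ∧ Prog.In F π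
  /-- the program belongs to the fragment `F`. -/
  def Prog.In : Frag → Prog → Prop
    | _, .eps => True
    | _, .atom _ => True
    | _, .conv _ => True
    | F, .union π₁ π₂ => Prog.In F π₁ ∧ Prog.In F π₂
    | F, .comp π₁ π₂ => Prog.In F π₁ ∧ Prog.In F π₂
    | F, .star π => Prog.In F π
    | F, .test φ => Fml.In F φ
    | F, .inter π₁ π₂ => F.interOK ∧ Prog.In F π₁ ∧ Prog.In F π₂
    | F, .univ => F.univOK
    | F, .cq ps rs xs xt => F.cqOK ps rs xs xt ∧ cqWF ps rs xs xt ∧ PList.In F ps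
  /-- all programs of the list belong to the fragment `F`. -/
  def PList.In : Frag → PList → Prop
    | _, .nil => True
    | F, .cons π _ _ ps => Prog.In F π ∧ PList.In F ps
end

/-- CPDL: PDL with converse. -/
def Frag.cpdl : Frag := ⟨False, False, False, fun _ _ _ _ => False⟩
/-- ICPDL: CPDL with program intersection. -/
def Frag.icpdl : Frag := ⟨False, True, False, fun _ _ _ _ => False⟩
/-- loop-CPDL: CPDL with `loop(π)` formulas. -/
def Frag.loopCpdl : Frag := ⟨True, False, False, fun _ _ _ _ => False⟩
/-- CPDL⁺: CPDL with conjunctive programs. -/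
def Frag.cpdlPlus : Frag := ⟨False, False, False, fun _ _ _ _ => True⟩
/-- UCPDL⁺: CPDL⁺ with the universal program. -/
def Frag.ucpdlPlus : Frag := ⟨False, False, True, fun _ _ _ _ => True⟩
/-- CPDL⁺(TW_k): conjunctive programs with underlying graph of tree-width `≤ k`. -/
def Frag.tw (k : ℕ) : Frag :=
  ⟨False, False, False, fun ps rs xs xt =>
    TreewidthLE {x | x ∈ cqVars ps rs} (ugAdj ps rs xs xt) k⟩
/-- UCPDL⁺(TW_k). -/
def Frag.utw (k : ℕ) : Frag :=
  ⟨False, False, True, fun ps rs xs xt =>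
    TreewidthLE {x | x ∈ cqVars ps rs} (ugAdj ps rs xs xt) k⟩
/-- CPDL⁺(𝒢↺): the only conjunctive programs are `C[x,x]` where all atoms
are p-atoms of the form `π(x,x)`. -/
def Frag.gloop : Frag :=
  ⟨False, False, False, fun ps rs xs xt => xt = xs ∧ rs = [] ∧ PList.allOn xs ps⟩
/-- ICPDL⁺(TW₂): CPDL⁺(TW₂) together with program intersection. -/
def Frag.icpdlPlusTw2 : Frag :=
  ⟨False, True, False, fun ps rs xs xt =>
    TreewidthLE {x | x ∈ cqVars ps rs} (ugAdj ps rs xs xt) 2⟩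

mutual
  /-- positive formulas: no occurrence of negation. -/
  def Fml.Positive : Fml → Prop
    | .prop _ => True
    | .neg _ => False
    | .and φ ψ => Fml.Positive φ ∧ Fml.Positive ψ
    | .diam π => Prog.Positive π
    | .loop π => Prog.Positive π
  /-- positive programs. -/
  def Prog.Positive : Prog → Prop
    | .eps => True
    | .atom _ => True
    | .conv _ => True
    | .union π₁ π₂ => Prog.Positive π₁ ∧ Prog.Positive π₂
    | .comp π₁ π₂ => Prog.Positive π₁ ∧ Prog.Positive π₂
    | .star π => Prog.Positive π
    | .test φ => Fml.Positive φ
    | .inter π₁ π₂ => Prog.Positive π₁ ∧ Prog.Positive π₂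
    | .univ => True
    | .cq ps _ _ _ => PList.Positive ps
  /-- positive p-atom lists. -/
  def PList.Positive : PList → Prop
    | .nil => True
    | .cons π _ _ ps => Prog.Positive π ∧ PList.Positive ps
end

/-! ## Sizes, conjunctive width, intersection width -/

/-- sum of the arities of a list of r-atoms. -/
def ratomSize (rs : List RAtom) : ℕ := (rs.map fun r => r.args.length).sum

mutual
  /-- size of a formula. -/
  def Fml.fsize : Fml → ℕ
    | .prop _ => 1
    | .neg φ => 1 + Fml.fsize φ
    | .and φ ψ => Fml.fsize φ + Fml.fsize ψ
    | .diam π => 1 + Prog.psize π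
    | .loop π => 1 + Prog.psize π
  /-- size of a program. -/
  def Prog.psize : Prog → ℕ
    | .eps => 1
    | .atom _ => 1
    | .conv _ => 1
    | .union π₁ π₂ => Prog.psize π₁ + Prog.psize π₂
    | .comp π₁ π₂ => Prog.psize π₁ + Prog.psize π₂
    | .star π => 1 + Prog.psize π
    | .test φ => 1 + Fml.fsize φ
    | .inter π₁ π₂ => Prog.psize π₁ + Prog.psize π₂
    | .univ => 1
    | .cq ps rs _ _ => ratomSize rs + PList.plsize ps
  /-- size of a p-atom list: `Σ (1 + |π|)`. -/
  def PList.plsize : PList → ℕ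
    | .nil => 0
    | .cons π _ _ ps => 1 + Prog.psize π + PList.plsize ps
end

mutual
  /-- conjunctive width of a program. -/
  def Prog.cw : Prog → ℕ
    | .eps => 1
    | .atom _ => 1
    | .conv _ => 1
    | .union π₁ π₂ => max (Prog.cw π₁) (Prog.cw π₂)
    | .comp π₁ π₂ => max (Prog.cw π₁) (Prog.cw π₂)
    | .star π => Prog.cw π
    | .test _ => 1
    | .inter π₁ π₂ => Prog.cw π₁ + Prog.cw π₂
    | .univ => 1
    | .cq ps rs _ _ => ratomSize rs + PList.cwSum ps
  /-- sum of the conjunctive widths of the programs of a p-atom list. -/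
  def PList.cwSum : PList → ℕ
    | .nil => 0
    | .cons π _ _ ps => Prog.cw π + PList.cwSum ps
end

mutual
  /-- conjunctive width of a formula: max of `Prog.cw` over all programs therein. -/
  def Fml.cwE : Fml → ℕ
    | .prop _ => 1
    | .neg φ => Fml.cwE φ
    | .and φ ψ => max (Fml.cwE φ) (Fml.cwE ψ)
    | .diam π => Prog.cwE π
    | .loop π => Prog.cwE π
  /-- conjunctive width of an expression which is a program. -/
  def Prog.cwE : Prog → ℕ
    | .eps => 1
    | .atom _ => 1
    | .conv _ => 1
    | .union π₁ π₂ => max (Prog.cwE π₁) (Prog.cwE π₂)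
    | .comp π₁ π₂ => max (Prog.cwE π₁) (Prog.cwE π₂)
    | .star π => Prog.cwE π
    | .test φ => Fml.cwE φ
    | .inter π₁ π₂ => max (Prog.cw (.inter π₁ π₂)) (max (Prog.cwE π₁) (Prog.cwE π₂))
    | .univ => 1
    | .cq ps rs xs xt => max (Prog.cw (.cq ps rs xs xt)) (PList.cwEMax ps)
  /-- max conjunctive width over a p-atom list. -/
  def PList.cwEMax : PList → ℕ
    | .nil => 1
    | .cons π _ _ ps => max (Prog.cwE π) (PList.cwEMax ps)
end

mutual
  /-- intersection width of an (I)CPDL program. -/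
  def Prog.iw : Prog → ℕ
    | .eps => 1
    | .atom _ => 1
    | .conv _ => 1
    | .union π₁ π₂ => max (Prog.iw π₁) (Prog.iw π₂)
    | .comp π₁ π₂ => max (Prog.iw π₁) (Prog.iw π₂)
    | .star π => Prog.iw π
    | .test _ => 1
    | .inter π₁ π₂ => Prog.iw π₁ + Prog.iw π₂
    | .univ => 1
    | .cq _ _ _ _ => 1
  /-- max intersection width over a p-atom list (unused on ICPDL). -/
  def PList.iwMax : PList → ℕ
    | .nil => 1
    | .cons π _ _ ps => max (Prog.iwE π) (PList.iwMax ps)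
  /-- intersection width of an expression which is a program. -/
  def Prog.iwE : Prog → ℕ
    | .eps => 1
    | .atom _ => 1
    | .conv _ => 1
    | .union π₁ π₂ => max (Prog.iwE π₁) (Prog.iwE π₂)
    | .comp π₁ π₂ => max (Prog.iwE π₁) (Prog.iwE π₂)
    | .star π => Prog.iwE π
    | .test φ => Fml.iwE φ
    | .inter π₁ π₂ => max (Prog.iw (.inter π₁ π₂)) (max (Prog.iwE π₁) (Prog.iwE π₂))
    | .univ => 1
    | .cq ps _ _ _ => PList.iwMax ps
  /-- intersection width of a formula. -/
  def Fml.iwE : Fml → ℕ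
    | .prop _ => 1
    | .neg φ => Fml.iwE φ
    | .and φ ψ => max (Fml.iwE φ) (Fml.iwE ψ)
    | .diam π => Prog.iwE π
    | .loop π => Prog.iwE π
end

/-! ## Translations between fragments -/

/-- `Translatable F₁ F₂` (over Kripke structures): there are translations mapping
`F₁`-formulas to `F₂`-formulas and `F₁`-programs to `F₂`-programs preserving the
semantics on every Kripke structure; moreover the translations are polynomial-time
computable (witnessed here by a polynomial bound on the size of the output). -/
def Translatable (F₁ F₂ : Frag) : Prop :=
  ∃ (tf : Fml → Fml) (tp : Prog → Prog),
    (∀ φ, Fml.In F₁ φ → Fml.In F₂ (tf φ) ∧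
      ∀ K : Struct, K.IsKripke → ∀ w, evalF K φ w ↔ evalF K (tf φ) w) ∧
    (∀ π, Prog.In F₁ π → Prog.In F₂ (tp π) ∧
      ∀ K : Struct, K.IsKripke → ∀ u v, evalP K π u v ↔ evalP K (tp π) u v) ∧
    ∃ c : ℕ, (∀ φ, Fml.In F₁ φ → Fml.fsize (tf φ) ≤ c * (Fml.fsize φ + 1) ^ c) ∧
      ∀ π, Prog.In F₁ π → Prog.psize (tp π) ≤ c * (Prog.psize π + 1) ^ c

/-- `TranslatableAll F₁ F₂`: semantics-preserving translations over all structures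
(no effectivity requirement). -/
def TranslatableAll (F₁ F₂ : Frag) : Prop :=
  ∃ (tf : Fml → Fml) (tp : Prog → Prog),
    (∀ φ, Fml.In F₁ φ → Fml.In F₂ (tf φ) ∧
      ∀ (K : Struct) (w : K.World), evalF K φ w ↔ evalF K (tf φ) w) ∧
    ∀ π, Prog.In F₁ π → Prog.In F₂ (tp π) ∧
      ∀ (K : Struct) (u v : K.World), evalP K π u v ↔ evalP K (tp π) u v

/-- build a list of p-atoms `a(x,y)` (with `a` the atomic program named `0`)
from a list of pairs of variables. -/
def PList.ofPairs : List (ℕ × ℕ) → PList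
  | [] => .nil
  | (x, y) :: r => .cons (.atom 0) x y (PList.ofPairs r)

/-- the pairs `(i,j)` with `i < j < m`. -/
def cliquePairs (m : ℕ) : List (ℕ × ℕ) :=
  (List.range m).flatMap fun i =>
    (List.range m).filterMap fun j => if i < j then some (i, j) else none

/-- the `(m+1)`-clique formula `ξ_{m+1} = ⟨C[x₁,x_{m+1}]⟩ ∧ ¬⟨C'[x₁,y]⟩`, with
`C = {a(x_i,x_j) : i < j}` on the variables `0,…,m` and `C' = {a(x₁,y), a(y,y)}`. -/
def cliqueFml (m : ℕ) : Fml :=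
  .and (.diam (.cq (PList.ofPairs (cliquePairs (m + 1))) [] 0 m))
    (.neg (.diam (.cq (PList.ofPairs [(0, 1), (1, 1)]) [] 0 1)))

/-! ## Monotonicity in the tree-width -/

theorem TreewidthLE.mono {α : Type} {V : Set α} {adj : α → α → Prop} {k l : ℕ} (hkl : k ≤ l)
    (h : TreewidthLE V adj k) : TreewidthLE V adj l := by
  obtain ⟨td, htd⟩ := h
  exact ⟨td, fun b => ⟨(htd b).1, (htd b).2.trans (by omega)⟩⟩

mutual
  theorem Fml.In.tw_mono {k l : ℕ} (hkl : k ≤ l) :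
      ∀ φ : Fml, Fml.In (Frag.tw k) φ → Fml.In (Frag.tw l) φ
    | .prop _, _ => by simp [Fml.In]
    | .neg φ, h => by
        simp only [Fml.In] at h ⊢
        exact Fml.In.tw_mono hkl φ h
    | .and φ ψ, h => by
        simp only [Fml.In] at h ⊢
        exact ⟨Fml.In.tw_mono hkl φ h.1, Fml.In.tw_mono hkl ψ h.2⟩
    | .diam π, h => by
        simp only [Fml.In] at h ⊢
        exact Prog.In.tw_mono hkl π h
    | .loop π, h => by
        simp only [Fml.In] at h
        exact h.1.elim
  theorem Prog.In.tw_mono {k l : ℕ} (hkl : k ≤ l) :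
      ∀ π : Prog, Prog.In (Frag.tw k) π → Prog.In (Frag.tw l) π
    | .eps, _ => by simp [Prog.In]
    | .atom _, _ => by simp [Prog.In]
    | .conv _, _ => by simp [Prog.In]
    | .union π₁ π₂, h => by
        simp only [Prog.In] at h ⊢
        exact ⟨Prog.In.tw_mono hkl π₁ h.1, Prog.In.tw_mono hkl π₂ h.2⟩
    | .comp π₁ π₂, h => by
        simp only [Prog.In] at h ⊢
        exact ⟨Prog.In.tw_mono hkl π₁ h.1, Prog.In.tw_mono hkl π₂ h.2⟩
    | .star π, h => by
        simp only [Prog.In] at h ⊢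
        exact Prog.In.tw_mono hkl π h
    | .test φ, h => by
        simp only [Prog.In] at h ⊢
        exact Fml.In.tw_mono hkl φ h
    | .inter _ _, h => by
        simp only [Prog.In] at h
        exact h.1.elim
    | .univ, h => by
        simp only [Prog.In] at h
        exact h.elim
    | .cq ps rs xs xt, h => by
        simp only [Prog.In] at h ⊢
        exact ⟨h.1.mono hkl, h.2.1, PList.In.tw_mono hkl ps h.2.2⟩
  theorem PList.In.tw_mono {k l : ℕ} (hkl : k ≤ l) :
      ∀ ps : PList, PList.In (Frag.tw k) ps → PList.In (Frag.tw l) ps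
    | .nil, _ => by simp [PList.In]
    | .cons π _ _ ps, h => by
        simp only [PList.In] at h ⊢
        exact ⟨Prog.In.tw_mono hkl π h.1, PList.In.tw_mono hkl ps h.2⟩
end

/-! ## Choosing compatible data along a tree -/

/-- Compatible data can be chosen on all nodes of a tree, starting from a root, as soon as
good data at a node extends to each neighbour. -/
theorem exists_compatible_of_isTree {B X : Type} {T : SimpleGraph B} (hT : T.IsTree)
    (good : B → X → Prop) (link : B → B → X → X → Prop)
    (symm : ∀ a b x y, link a b x y → link b a y x)
    (step : ∀ b c x, T.Adj b c → good c x → ∃ y, good b y ∧ link b c y x)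
    (r : B) (x₀ : X) (h₀ : good r x₀) :
    ∃ g : B → X, g r = x₀ ∧ (∀ b, good b (g b)) ∧ ∀ a b, T.Adj a b → link a b (g a) (g b) := by
  classical
  have step' : ∀ b c x, ∃ y, T.Adj b c → good c x → good b y ∧ link b c y x := by
    intro b c x
    by_cases h : T.Adj b c ∧ good c x
    · obtain ⟨y, hy⟩ := step b c x h.1 h.2
      exact ⟨y, fun _ _ => hy⟩
    · exact ⟨x, fun h₁ h₂ => (h ⟨h₁, h₂⟩).elim⟩
  choose E hE using step'
  let G : ∀ b : B, T.Walk b r → X := fun b p =>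
    SimpleGraph.Walk.rec (motive := fun _ v _ => X) x₀ (fun {u v _} _ _ x => E u v x) p
  have hcons : ∀ (b c : B) (h : T.Adj b c) (p : T.Walk c r), G b (.cons h p) = E b c (G c p) :=
    fun _ _ _ _ => rfl
  have hgood : ∀ (b : B) (p : T.Walk b r), good b (G b p) := by
    intro b p
    induction p with
    | nil => exact h₀
    | cons h p ih => exact (hE _ _ _ h (ih h₀ fun _ _ _ _ => rfl)).1
  choose P hP hPu using fun b => hT.existsUnique_path b r
  have key : ∀ a b, ∀ h : T.Adj a b, P a = .cons h (P b) → link a b (G a (P a)) (G b (P b)) := by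
    intro a b h heq
    rw [heq, hcons a b h]
    exact (hE a b _ h (hgood b (P b))).2
  refine ⟨fun b => G b (P b), ?_, fun b => hgood b _, fun a b hab => ?_⟩
  · have : P r = .nil := (hPu r .nil (by simp)).symm
    simp only [this]
    rfl
  · by_cases hmem : a ∈ (P b).support
    · refine symm _ _ _ _ (key b a hab.symm ?_)
      have := hT.isAcyclic.path_concat (hP a).reverse (hP b).reverse hab (by simpa using hmem)
      simpa using congrArg SimpleGraph.Walk.reverse this
    · exact key a b hab (hPu a _ ((hP b).cons hmem)).symm

/-! ## Assignments with the same equality type -/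

/-- `f` and `g` identify the same pairs of elements of `S`. -/
def SameType {α β : Type} (S : Set ℕ) (f : ℕ → α) (g : ℕ → β) : Prop :=
  ∀ x ∈ S, ∀ y ∈ S, f x = f y ↔ g x = g y

theorem SameType.mono {α β : Type} {S T : Set ℕ} {f : ℕ → α} {g : ℕ → β} (hST : S ⊆ T)
    (h : SameType T f g) : SameType S f g :=
  fun x hx y hy => h x (hST hx) y (hST hy)

theorem SameType.exists_extend {α : Type} {n : ℕ} {S T : Set ℕ} (hS : S.Finite)
    (hn : S.ncard ≤ n) (hT : T ⊆ S) {f : ℕ → α} {g : ℕ → Fin n} (h : SameType T f g) :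
    ∃ g' : ℕ → Fin n, Set.EqOn g g' T ∧ SameType S f g' := by
  classical
  have main : ∀ D : Finset ℕ, (D : Set ℕ) ⊆ S →
      ∃ g' : ℕ → Fin n, Set.EqOn g g' T ∧ SameType (T ∪ D) f g' := by
    intro D
    induction D using Finset.induction_on with
    | empty => exact fun _ => ⟨g, fun _ _ => rfl, by simpa using h⟩
    | insert x D _ ih =>
      intro hD
      rw [Finset.coe_insert, Set.insert_subset_iff] at hD
      obtain ⟨g', hg', hst⟩ := ih hD.2
      have hU : T ∪ (insert x D : Finset ℕ) = insert x (T ∪ D) := by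
        rw [Finset.coe_insert, Set.union_insert]
      rw [hU]
      by_cases hx : x ∈ T ∪ (D : Set ℕ)
      · exact ⟨g', hg', by rwa [Set.insert_eq_of_mem hx]⟩
      have hxT : x ∉ T := fun h => hx (Or.inl h)
      obtain ⟨a, ha⟩ : ∃ a : Fin n, ∀ y ∈ T ∪ (D : Set ℕ), f x = f y ↔ a = g' y := by
        by_cases hy : ∃ y ∈ T ∪ (D : Set ℕ), f x = f y
        · obtain ⟨y, hy, hxy⟩ := hy
          exact ⟨g' y, fun z hz => by rw [hxy]; exact hst y hy z hz⟩
        · push Not at hy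
          have hsub : T ∪ (D : Set ℕ) ⊆ S := Set.union_subset hT hD.2
          have hlt : (g' '' (T ∪ (D : Set ℕ))).ncard < n :=
            calc _ ≤ (T ∪ (D : Set ℕ)).ncard := Set.ncard_image_le (hS.subset hsub)
              _ < S.ncard := Set.ncard_lt_ncard ⟨hsub, fun h => hx (h hD.1)⟩ hS
              _ ≤ n := hn
          obtain ⟨a, ha⟩ : ∃ a, a ∉ g' '' (T ∪ (D : Set ℕ)) := by
            by_contra! hall
            rw [Set.eq_univ_of_forall hall, Set.ncard_univ, Nat.card_fin] at hlt
            exact hlt.false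
          exact ⟨a, fun y hyU => ⟨fun e => (hy y hyU e).elim, fun e => (ha ⟨y, hyU, e.symm⟩).elim⟩⟩
      have hne : ∀ y ∈ T ∪ (D : Set ℕ), Function.update g' x a y = g' y := fun y hy =>
        Function.update_of_ne (by rintro rfl; exact hx hy) _ _
      refine ⟨Function.update g' x a, fun y hy => by rw [hne y (Or.inl hy)]; exact hg' hy, ?_⟩
      rintro y (rfl | hy) z (rfl | hz)
      · simp
      · rw [hne z hz, Function.update_self]
        exact ha z hz
      · rw [hne y hy, Function.update_self, eq_comm, ha y hy, eq_comm]
      · rw [hne y hy, hne z hz]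
        exact hst y hy z hz
  obtain ⟨g', hg', hst⟩ := main hS.toFinset (by simp)
  exact ⟨g', hg', hst.mono (by simp)⟩

/-- On a graph of tree-width at most `k`, an assignment can be copied to any set with more than
`k` elements, keeping the equality type on every edge, with prescribed values on one edge. -/
theorem TreewidthLE.exists_sameType {V : Set ℕ} {adj : ℕ → ℕ → Prop} {k n : ℕ}
    (h : TreewidthLE V adj k) (hk : k + 1 ≤ n) {α : Type} (f : ℕ → α) {s t : ℕ} (hst : adj s t)
    (u v : Fin n) (huv : f s = f t ↔ u = v) :
    ∃ g : ℕ → Fin n, g s = u ∧ g t = v ∧ ∀ x y, adj x y → (f x = f y ↔ g x = g y) := by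
  classical
  obtain ⟨td, hw⟩ := h
  obtain ⟨r, hsr, htr⟩ := td.cover_edge s t hst
  have hcard : ∀ b, (td.bag b).ncard ≤ n := fun b => (hw b).2.trans hk
  obtain ⟨g₀, hg₀, hr⟩ : ∃ g₀ : ℕ → Fin n, (g₀ s = u ∧ g₀ t = v) ∧ SameType (td.bag r) f g₀ := by
    let g : ℕ → Fin n := fun x => if x = s then u else v
    have hgs : g s = u := if_pos rfl
    have hgt : g t = v := by
      by_cases e : t = s
      · have : u = v := huv.1 (by rw [e])
        simp [g, this]
      · simp [g, e]
    have htype : SameType {s, t} f g := by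
      rintro x (rfl | rfl) y (rfl | rfl)
      · simp
      · rw [hgs, hgt, huv]
      · rw [hgs, hgt, eq_comm, huv, eq_comm]
      · simp
    obtain ⟨g', hg', hst'⟩ := htype.exists_extend (hw r).1 (hcard r)
      (Set.insert_subset hsr (Set.singleton_subset_iff.2 htr))
    exact ⟨g', ⟨by rw [← hg' (by simp), hgs], by rw [← hg' (by simp), hgt]⟩, hst'⟩
  obtain ⟨G, hGr, hgood, hlink⟩ := exists_compatible_of_isTree td.isTree
    (fun b g => SameType (td.bag b) f g)
    (fun a b g g' => Set.EqOn g g' (td.bag a ∩ td.bag b))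
    (fun a b x y hxy => by rw [Set.inter_comm]; exact hxy.symm)
    (fun b c g _ hg => by
      obtain ⟨g', hg', hst'⟩ := SameType.exists_extend (hw b).1 (hcard b)
        Set.inter_subset_left (hg.mono Set.inter_subset_right)
      exact ⟨g', hst', hg'.symm⟩)
    r g₀ hr
  have hwalk : ∀ (x : ℕ) (b c : td.B) (p : td.tree.Walk b c),
      (∀ d ∈ p.support, x ∈ td.bag d) → G b x = G c x := by
    intro x b c p
    induction p with
    | nil => exact fun _ => rfl
    | cons h p ih =>
      intro hx
      rw [SimpleGraph.Walk.support_cons] at hx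
      exact (hlink _ _ h ⟨hx _ (by simp), hx _ (by simp)⟩).trans
        (ih fun d hd => hx d (List.mem_cons_of_mem _ hd))
  let g : ℕ → Fin n := fun x => if hx : ∃ b, x ∈ td.bag b then G hx.choose x else u
  have hg : ∀ b, ∀ x ∈ td.bag b, g x = G b x := by
    intro b x hx
    have hex : ∃ b, x ∈ td.bag b := ⟨b, hx⟩
    obtain ⟨p, hp⟩ := td.bags_conn x _ b hex.choose_spec hx
    simp only [g, dif_pos hex]
    exact hwalk x _ _ p hp
  refine ⟨g, by rw [hg r s hsr, hGr, hg₀.1], by rw [hg r t htr, hGr, hg₀.2], fun x y hxy => ?_⟩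
  obtain ⟨b, hx, hy⟩ := td.cover_edge x y hxy
  rw [hg b x hx, hg b y hy]
  exact hgood b x hx y hy

/-! ## Complete loopless Kripke structures -/

/-- The complete loopless graph on `n` worlds, with edge relation the atomic program `0`. -/
abbrev completeStruct (n : ℕ) : Struct where
  World := Fin n
  rel l r t := l = 2 ∧ r = 0 ∧ Function.Injective t

theorem completeStruct_isKripke (n : ℕ) : (completeStruct n).IsKripke :=
  fun _ hl _ _ h => hl.ne' h.1

theorem completeStruct_prog {n a : ℕ} {u v : Fin n} :
    (completeStruct n).prog a u v ↔ a = 0 ∧ u ≠ v := by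
  simp only [Struct.prog, true_and]
  refine and_congr_right fun _ => ⟨fun h e => ?_, fun h i j hij => ?_⟩
  · have := @h 0 1 (by simpa using e)
    simp at this
  · fin_cases i <;> fin_cases j <;> simp_all [eq_comm]

theorem Fin.exists_same_type {n l : ℕ} (hl : 3 ≤ l) (u v w : Fin n) (u' v' : Fin l)
    (huv : u = v ↔ u' = v') : ∃ w' : Fin l, (u = w ↔ u' = w') ∧ (w = v ↔ w' = v') := by
  classical
  by_cases h₁ : w = u
  · exact ⟨u', by simp [h₁], by rw [h₁, huv]⟩
  by_cases h₂ : w = v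
  · exact ⟨v', by rw [h₂, huv], by simp [h₂]⟩
  obtain ⟨w', hw'⟩ : ∃ w', w' ∉ ({u', v'} : Finset (Fin l)) := by
    by_contra! hall
    have h := Finset.card_le_two (a := u') (b := v')
    rw [Finset.eq_univ_iff_forall.2 hall, Finset.card_univ, Fintype.card_fin] at h
    omega
  simp only [Finset.mem_insert, Finset.mem_singleton, not_or] at hw'
  exact ⟨w', by simp [Ne.symm h₁, Ne.symm hw'.1], by simp [h₂, hw'.2]⟩

mutual
  /-- Formulas of `CPDL⁺(TW_k)` do not distinguish complete loopless graphs with more than `k`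
  worlds. -/
  theorem evalF_completeStruct {k : ℕ} (hk : 2 ≤ k) : ∀ (φ : Fml), Fml.In (Frag.tw k) φ →
      ∀ {n l : ℕ}, k + 1 ≤ n → k + 1 ≤ l → ∀ (u : Fin n) (u' : Fin l),
        evalF (completeStruct n) φ u → evalF (completeStruct l) φ u'
    | .prop p, _, n, l, _, _, u, u', h => by
        simp only [evalF, Struct.prop] at h
        exact absurd h.1 (by decide)
    | .neg φ, hφ, n, l, hn, hl, u, u', h => by
        simp only [evalF, Fml.In] at h hφ ⊢
        exact fun h' => h (evalF_completeStruct hk φ hφ hl hn u' u h')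
    | .and φ ψ, hφ, n, l, hn, hl, u, u', h => by
        simp only [evalF, Fml.In] at h hφ ⊢
        exact ⟨evalF_completeStruct hk φ hφ.1 hn hl u u' h.1,
          evalF_completeStruct hk ψ hφ.2 hn hl u u' h.2⟩
    | .diam π, hφ, n, l, hn, hl, u, u', h => by
        simp only [evalF, Fml.In] at h hφ ⊢
        obtain ⟨v, hv⟩ := h
        obtain ⟨v', hv', -⟩ := Fin.exists_same_type (by omega) u u v u' u' (by simp)
        exact ⟨v', evalP_completeStruct hk π hφ hn hl u v u' v' hv' hv⟩
    | .loop _, hφ, _, _, _, _, _, _, _ => by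
        simp only [Fml.In] at hφ
        exact hφ.1.elim
  /-- Programs of `CPDL⁺(TW_k)` only see the equality type of a pair of worlds of a complete
  loopless graph with more than `k` worlds. -/
  theorem evalP_completeStruct {k : ℕ} (hk : 2 ≤ k) : ∀ (π : Prog), Prog.In (Frag.tw k) π →
      ∀ {n l : ℕ}, k + 1 ≤ n → k + 1 ≤ l → ∀ (u v : Fin n) (u' v' : Fin l), (u = v ↔ u' = v') →
        evalP (completeStruct n) π u v → evalP (completeStruct l) π u' v'
    | .eps, _, n, l, _, _, u, v, u', v', huv, h => by
        simp only [evalP] at h ⊢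
        exact huv.1 h
    | .atom a, _, n, l, _, _, u, v, u', v', huv, h => by
        simp only [evalP, completeStruct_prog] at h ⊢
        exact ⟨h.1, fun e => h.2 (huv.2 e)⟩
    | .conv a, _, n, l, _, _, u, v, u', v', huv, h => by
        simp only [evalP, completeStruct_prog] at h ⊢
        exact ⟨h.1, fun e => h.2 (huv.2 e.symm).symm⟩
    | .union π₁ π₂, hπ, n, l, hn, hl, u, v, u', v', huv, h => by
        simp only [evalP, Prog.In] at h hπ ⊢
        exact h.imp (evalP_completeStruct hk π₁ hπ.1 hn hl u v u' v' huv)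
          (evalP_completeStruct hk π₂ hπ.2 hn hl u v u' v' huv)
    | .comp π₁ π₂, hπ, n, l, hn, hl, u, v, u', v', huv, h => by
        simp only [evalP, Prog.In] at h hπ ⊢
        obtain ⟨w, h₁, h₂⟩ := h
        obtain ⟨w', huw, hwv⟩ := Fin.exists_same_type (by omega) u v w u' v' huv
        exact ⟨w', evalP_completeStruct hk π₁ hπ.1 hn hl u w u' w' huw h₁,
          evalP_completeStruct hk π₂ hπ.2 hn hl w v w' v' hwv h₂⟩
    | .star π, hπ, n, l, hn, hl, u, v, u', v', huv, h => by
        simp only [evalP, Prog.In] at h hπ ⊢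
        induction h using Relation.ReflTransGen.head_induction_on generalizing u' with
        | refl => exact huv.1 rfl ▸ .refl
        | @head u w huw _ ih =>
          obtain ⟨w', huw', hwv⟩ := Fin.exists_same_type (by omega) u v w u' v' huv
          exact .head (evalP_completeStruct hk π hπ hn hl u w u' w' huw' huw) (ih w' hwv)
    | .test φ, hπ, n, l, hn, hl, u, v, u', v', huv, h => by
        simp only [evalP, Prog.In] at h hπ ⊢
        exact ⟨huv.1 h.1, evalF_completeStruct hk φ hπ hn hl u u' h.2⟩
    | .inter _ _, hπ, _, _, _, _, _, _, _, _, _, _ => by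
        simp only [Prog.In] at hπ
        exact hπ.1.elim
    | .univ, hπ, _, _, _, _, _, _, _, _, _, _ => by
        simp only [Prog.In] at hπ
        exact hπ.elim
    | .cq ps rs xs xt, hπ, n, l, hn, hl, u, v, u', v', huv, h => by
        simp only [evalP, Prog.In] at h hπ ⊢
        obtain ⟨f, rfl, rfl, hps, hrs⟩ := h
        obtain ⟨htw, hwf, hin⟩ := hπ
        obtain ⟨g, hs, ht, hg⟩ := TreewidthLE.exists_sameType htw hl f
          (Or.inr (Or.inl ⟨rfl, rfl⟩)) u' v' huv
        refine ⟨g, hs, ht, ?_, fun r hr => ?_⟩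
        · exact evalPL_completeStruct hk ps hin hn hl f g
            (fun x y hxy => hg x y (Or.inl (Or.inl hxy))) hps
        · exact absurd (hrs r hr).1 (hwf.2.2.1 r hr).ne'
  /-- Lists of p-atoms of `CPDL⁺(TW_k)` only see the equality types of pairs of co-occurring
  variables. -/
  theorem evalPL_completeStruct {k : ℕ} (hk : 2 ≤ k) : ∀ (ps : PList), PList.In (Frag.tw k) ps →
      ∀ {n l : ℕ}, k + 1 ≤ n → k + 1 ≤ l → ∀ (f : ℕ → Fin n) (g : ℕ → Fin l),
        (∀ x y, ps.coOcc x y → (f x = f y ↔ g x = g y)) →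
        evalPL (completeStruct n) f ps → evalPL (completeStruct l) g ps
    | .nil, _, _, _, _, _, _, _, _, _ => by simp [evalPL]
    | .cons π x y ps, hps, n, l, hn, hl, f, g, hfg, h => by
        simp only [evalPL, PList.In] at h hps ⊢
        exact ⟨evalP_completeStruct hk π hps.1 hn hl _ _ _ _ (hfg x y (by simp [PList.coOcc])) h.1,
          evalPL_completeStruct hk ps hps.2 hn hl f g
            (fun a b hab => hfg a b (by simp [PList.coOcc, hab])) h.2⟩
end

/-! ## The clique formula -/

theorem mem_cliquePairs {m i j : ℕ} : (i, j) ∈ cliquePairs m ↔ i < j ∧ j < m := by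
  simp only [cliquePairs, List.mem_flatMap, List.mem_range, List.mem_filterMap]
  constructor
  · rintro ⟨a, ha, b, hb, h⟩
    split_ifs at h with hab
    · cases h
      exact ⟨hab, hb⟩
  · rintro ⟨h₁, h₂⟩
    exact ⟨i, by omega, j, h₂, by simp [h₁]⟩

theorem PList.mem_vars_ofPairs {x : ℕ} {L : List (ℕ × ℕ)} :
    x ∈ (PList.ofPairs L).vars ↔ ∃ p ∈ L, x = p.1 ∨ x = p.2 := by
  induction L with
  | nil => simp [PList.ofPairs, PList.vars]
  | cons p L ih => simp [PList.ofPairs, PList.vars, ih, or_assoc]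

theorem PList.coOcc_ofPairs {x y : ℕ} {L : List (ℕ × ℕ)} :
    (PList.ofPairs L).coOcc x y ↔ ∃ p ∈ L, (x = p.1 ∨ x = p.2) ∧ (y = p.1 ∨ y = p.2) := by
  induction L with
  | nil => simp [PList.ofPairs, PList.coOcc]
  | cons p L ih => simp [PList.ofPairs, PList.coOcc, ih]

theorem PList.in_ofPairs (F : Frag) (L : List (ℕ × ℕ)) : PList.In F (PList.ofPairs L) := by
  induction L with
  | nil => simp [PList.ofPairs, PList.In]
  | cons p L ih => simp [PList.ofPairs, PList.In, Prog.In, ih]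

theorem evalPL_ofPairs {K : Struct} {f : ℕ → K.World} {L : List (ℕ × ℕ)} :
    evalPL K f (PList.ofPairs L) ↔ ∀ p ∈ L, K.prog 0 (f p.1) (f p.2) := by
  induction L with
  | nil => simp [PList.ofPairs, evalPL]
  | cons p L ih => simp [PList.ofPairs, evalPL, evalP, ih]

theorem cqVars_ofPairs_cliquePairs {m : ℕ} (hm : 1 ≤ m) {x : ℕ} :
    x ∈ cqVars (PList.ofPairs (cliquePairs (m + 1))) [] ↔ x ≤ m := by
  simp only [cqVars, List.map_nil, List.flatten_nil, List.append_nil, PList.mem_vars_ofPairs,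
    Prod.exists, mem_cliquePairs]
  constructor
  · rintro ⟨i, j, h, rfl | rfl⟩ <;> omega
  · intro hx
    rcases Nat.eq_zero_or_pos x with rfl | h
    · exact ⟨0, m, by omega, Or.inl rfl⟩
    · exact ⟨0, x, by omega, Or.inr rfl⟩

/-- A graph all of whose edges lie in a set of at most `k + 1` vertices has tree-width at most
`k`. -/
theorem TreewidthLE.of_ncard_le {α : Type} {V : Set α} {adj : α → α → Prop} {k : ℕ}
    (hV : V.Finite) (hcard : V.ncard ≤ k + 1) (hadj : ∀ u v, adj u v → u ∈ V ∧ v ∈ V) :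
    TreewidthLE V adj k :=
  ⟨{ B := Unit
     tree := ⊥
     isTree := .of_subsingleton
     bag := fun _ => V
     cover_vert := fun _ hv => ⟨(), hv⟩
     cover_edge := fun u v h => ⟨(), hadj u v h⟩
     bags_conn := fun _ _ _ h _ => ⟨.nil, fun _ _ => h⟩ }, fun _ => ⟨hV, hcard⟩⟩

theorem mem_cqVars_of_ugAdj {L : List (ℕ × ℕ)} {s t x y : ℕ}
    (hs : s ∈ cqVars (PList.ofPairs L) []) (ht : t ∈ cqVars (PList.ofPairs L) [])
    (h : ugAdj (PList.ofPairs L) [] s t x y) :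
    x ∈ cqVars (PList.ofPairs L) [] ∧ y ∈ cqVars (PList.ofPairs L) [] := by
  rcases h with (h | ⟨r, hr, -⟩) | ⟨rfl, rfl⟩ | ⟨rfl, rfl⟩
  · obtain ⟨p, hp, hx, hy⟩ := PList.coOcc_ofPairs.1 h
    simp only [cqVars, List.map_nil, List.flatten_nil, List.append_nil, PList.mem_vars_ofPairs]
    exact ⟨⟨p, hp, hx⟩, p, hp, hy⟩
  · simp at hr
  · exact ⟨hs, ht⟩
  · exact ⟨ht, hs⟩

/-- A conjunctive program over the atomic program `0` with at most `k + 1` variables, any two of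
which co-occur, belongs to `CPDL⁺(TW_k)`. -/
theorem Prog.in_tw_ofPairs {L : List (ℕ × ℕ)} {s t n k : ℕ} (hn : n ≤ k)
    (hvars : ∀ x, x ∈ cqVars (PList.ofPairs L) [] ↔ x ≤ n) (hs : s ≤ n) (ht : t ≤ n)
    (hL : ∀ i j, i < j → j ≤ n → (i, j) ∈ L) :
    Prog.In (Frag.tw k) (.cq (PList.ofPairs L) [] s t) := by
  have hset : {x | x ∈ cqVars (PList.ofPairs L) []} = Set.Iic n := by
    ext x
    exact hvars x
  simp only [Prog.In]
  refine ⟨?_, ⟨(hvars s).2 hs, (hvars t).2 ht, by simp, fun x hx y hy => ?_⟩, PList.in_ofPairs _ _⟩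
  · refine TreewidthLE.of_ncard_le ?_ ?_
      fun x y => mem_cqVars_of_ugAdj ((hvars s).2 hs) ((hvars t).2 ht)
    · rw [hset]
      exact Set.finite_Iic n
    · rw [hset, Set.ncard_eq_toFinset_card', Set.toFinset_Iic, Nat.card_Iic]
      omega
  · rw [hvars] at hx hy
    rcases lt_trichotomy x y with h | rfl | h
    · exact .single (Or.inl (PList.coOcc_ofPairs.2 ⟨_, hL x y h hy, by simp, by simp⟩))
    · exact .refl
    · exact .single (Or.inl (PList.coOcc_ofPairs.2 ⟨_, hL y x h hx, by simp, by simp⟩))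

theorem cliqueFml_in_tw {m : ℕ} (hm : 1 ≤ m) : Fml.In (Frag.tw m) (cliqueFml m) := by
  simp only [cliqueFml, Fml.In]
  constructor
  · exact Prog.in_tw_ofPairs le_rfl (fun x => cqVars_ofPairs_cliquePairs hm) (by omega) le_rfl
      fun i j hij hj => mem_cliquePairs.2 ⟨hij, by omega⟩
  · refine Prog.in_tw_ofPairs hm (fun x => ?_) (by omega) le_rfl fun i j hij hj => ?_
    · simp only [cqVars, List.map_nil, List.flatten_nil, List.append_nil, PList.mem_vars_ofPairs]
      simp
      omega
    · obtain ⟨rfl, rfl⟩ : i = 0 ∧ j = 1 := by omega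
      simp

/-- The clique formula holds in the complete loopless graph with one world per variable. -/
theorem evalF_cliqueFml (m : ℕ) :
    evalF (completeStruct (m + 1)) (cliqueFml m) (0 : Fin (m + 1)) := by
  simp only [cliqueFml, evalF, evalP, evalPL_ofPairs, completeStruct_prog]
  refine ⟨⟨Fin.last m, Fin.ofNat (m + 1), ?_, ?_, ?_, by simp⟩, ?_⟩
  · simp
  · ext
    simp
  · rintro ⟨i, j⟩ h
    obtain ⟨hij, hj⟩ := mem_cliquePairs.1 h
    refine ⟨trivial, fun e => ?_⟩
    have := congrArg Fin.val e
    simp only [Fin.val_ofNat, Nat.mod_eq_of_lt hj, Nat.mod_eq_of_lt (hij.trans hj)] at this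
    omega
  · rintro ⟨v, f, -, -, h, -⟩
    exact (h (1, 1) (by simp)).2 rfl

/-- The clique formula fails in complete loopless graphs with fewer worlds than variables. -/
theorem not_evalF_cliqueFml (m : ℕ) (w : Fin m) : ¬ evalF (completeStruct m) (cliqueFml m) w := by
  simp only [cliqueFml, evalF, evalP, evalPL_ofPairs, completeStruct_prog]
  rintro ⟨⟨v, f, -, -, h, -⟩, -⟩
  have hne : ∀ i j, i < j → j < m + 1 → f i ≠ f j := fun i j hij hj =>
    (h (i, j) (mem_cliquePairs.2 ⟨hij, hj⟩)).2
  have hinj : Function.Injective fun i : Fin (m + 1) => f i := by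
    intro i j hij
    by_contra hne'
    rcases lt_or_gt_of_ne hne' with hlt | hlt
    · exact hne i j hlt j.2 hij
    · exact hne j i hlt i.2 hij.symm
  simpa using Fintype.card_le_of_injective _ hinj

theorem cliqueFml_not_equiv_tw {m k : ℕ} (hk : 2 ≤ k) (hm : k + 1 = m) :
    ¬ ∃ ψ : Fml, Fml.In (Frag.tw k) ψ ∧
      ∀ K : Struct, K.IsKripke → ∀ w, evalF K (cliqueFml m) w ↔ evalF K ψ w := by
  rintro ⟨ψ, hψ, h⟩
  have hw : 0 < m := by omega
  have h₁ := (h _ (completeStruct_isKripke (m + 1)) (0 : Fin (m + 1))).1 (evalF_cliqueFml m)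
  have h₂ := evalF_completeStruct hk ψ hψ (by omega) hm.le (0 : Fin (m + 1)) ⟨0, hw⟩ h₁
  exact not_evalF_cliqueFml m _ ((h _ (completeStruct_isKripke m) _).2 h₂)

/-- For every `k ≥ 2`, CPDL⁺(TW_k) is strictly less expressive
than CPDL⁺(TW_{k+1}); concretely, for every `m ≥ 3` the `(m+1)`-clique formula is
in CPDL⁺(TW_m), satisfiable, and not equivalent over Kripke structures to any
CPDL⁺(TW_{m-1}) formula. -/
theorem statement_11 (k : ℕ) (hk : 2 ≤ k) :
    TranslatableAll (Frag.tw k) (Frag.tw (k + 1)) ∧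
    (∃ φ : Fml, Fml.In (Frag.tw (k + 1)) φ ∧
      ¬ ∃ ψ : Fml, Fml.In (Frag.tw k) ψ ∧
        ∀ K : Struct, K.IsKripke → ∀ w, evalF K φ w ↔ evalF K ψ w) ∧
    ∀ m : ℕ, 3 ≤ m →
      Fml.In (Frag.tw m) (cliqueFml m) ∧
      (∃ K : Struct, K.IsKripke ∧ ∃ w, evalF K (cliqueFml m) w) ∧
      ¬ ∃ ψ : Fml, Fml.In (Frag.tw (m - 1)) ψ ∧
        ∀ K : Struct, K.IsKripke → ∀ w, evalF K (cliqueFml m) w ↔ evalF K ψ w := by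
  refine ⟨⟨id, id, fun φ h => ⟨Fml.In.tw_mono k.le_succ φ h, fun _ _ => Iff.rfl⟩,
    fun π h => ⟨Prog.In.tw_mono k.le_succ π h, fun _ _ _ => Iff.rfl⟩⟩,
    ⟨cliqueFml (k + 1), cliqueFml_in_tw (by omega), cliqueFml_not_equiv_tw hk rfl⟩,
    fun m hm => ⟨cliqueFml_in_tw (by omega), ⟨_, completeStruct_isKripke (m + 1), _,
      evalF_cliqueFml m⟩, cliqueFml_not_equiv_tw (by omega) (by omega)⟩⟩

end PaperCPDL
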